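/- arXiv:1508.02260 — 2 statements merged into one kernel-verified Lean document; each statement's English description precedes it below -/
import Mathlib

section
/- Let M_P be a holomorphically nondegenerate model hypersurface, Y = f₁∂/∂z₁ + f₂∂/∂z₂ a generalized rotation of M_P, and suppose P(z,z̄) = Σ_{j=1}^{M} Re( Σ_{k=1}^{N_j} U_j^k(z) · conj(V_j^{N_j−k+1}(z)) ), where for each j the sequences {U_j^k}, {V_j^k} form a symmetric pair of Y-chains of length N_j. Then at least one index j satisfies N_j ≥ 2. -/
open MvPolynomial Complex

noncomputable section

/-- Polynomials in the two holomorphic variables `z₁, z₂`. -/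
abbrev P2 := MvPolynomial (Fin 2) ℂ

/-- Polynomials in `z₁, z₂` (indexed by `Sum.inl`) and the antiholomorphic
variables `z̄₁, z̄₂` (indexed by `Sum.inr`). -/
abbrev P4 := MvPolynomial (Fin 2 ⊕ Fin 2) ℂ

/-- Substitution `(z, z̄)`. -/
def mix (z : Fin 2 → ℂ) : Fin 2 ⊕ Fin 2 → ℂ :=
  Sum.elim z (fun j => (starRingEnd ℂ) (z j))

/-- Action of the vector field `Y = f₀ ∂/∂z₁ + f₁ ∂/∂z₂` on `ℂ[z₁,z₂]`. -/
def vf (f : Fin 2 → P2) (q : P2) : P2 :=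
  f 0 * pderiv 0 q + f 1 * pderiv 1 q

/-- A polynomial in `z, z̄` vanishing at all `(z, z̄)` is zero. -/
theorem eq_zero_of_eval_mix (Q : P4) (h : ∀ z, eval (mix z) Q = 0) : Q = 0 := by
  let φ : Fin 2 ⊕ Fin 2 → P4 := Sum.elim
    (fun j => X (Sum.inl j) + C I * X (Sum.inr j)) (fun j => X (Sum.inl j) - C I * X (Sum.inr j))
  have eval_bind (w) : eval w (bind₁ φ Q) = eval (fun i => eval w (φ i)) Q :=
    eval₂Hom_bind₁ (RingHom.id ℂ) w φ Q
  have hzero : bind₁ φ Q = 0 := by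
    refine funext_set (fun _ => Set.range ((↑) : ℝ → ℂ))
      (fun _ => Set.infinite_range_of_injective ofReal_injective) fun w hw => ?_
    have hreal (i) : (starRingEnd ℂ) (w i) = w i := by
      obtain ⟨r, hr⟩ := hw i (Set.mem_univ i)
      rw [← hr, conj_ofReal]
    rw [eval_bind, map_zero, ← h fun j => w (Sum.inl j) + I * w (Sum.inr j)]
    congr 2
    ext i
    rcases i with i | i <;> simp [φ, mix, hreal, sub_eq_add_neg]
  refine MvPolynomial.funext fun w => ?_
  have hw := eval_bind (Sum.elim (fun j => (w (Sum.inl j) + w (Sum.inr j)) / 2)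
    (fun j => (w (Sum.inl j) - w (Sum.inr j)) / (2 * I)))
  rw [hzero, map_zero] at hw
  rw [map_zero, hw]
  congr 2
  ext i
  rcases i with i | i <;> simp [φ] <;> field_simp <;> ring

/-- The antiholomorphic polynomial `conj (q z)`. -/
def conjPoly (q : P2) : P4 := rename Sum.inr (map (starRingEnd ℂ) q)

theorem eval_mix_conjPoly (z : Fin 2 → ℂ) (q : P2) :
    eval (mix z) (conjPoly q) = (starRingEnd ℂ) (eval z q) := by
  induction q using MvPolynomial.induction_on with
  | C a => simp [conjPoly]
  | add p q hp hq => simp_all [conjPoly]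
  | mul_X p i hp => simp_all [conjPoly, mix]

theorem eval_mix_rename_inl (z : Fin 2 → ℂ) (q : P2) :
    eval (mix z) (rename Sum.inl q) = eval z q := by
  rw [eval_rename]; rfl

/-- A vector field with holomorphic coefficients, acting on polynomials in `z, z̄`. -/
def holVF (f : Fin 2 → P2) : Derivation ℂ P4 P4 :=
  (rename Sum.inl (f 0) : P4) • pderiv (Sum.inl 0) +
    (rename Sum.inl (f 1) : P4) • pderiv (Sum.inl 1)

theorem holVF_conjPoly (f : Fin 2 → P2) (q : P2) : holVF f (conjPoly q) = 0 := by
  induction q using MvPolynomial.induction_on with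
  | C a => simp [conjPoly, holVF]
  | add p q hp hq => simp_all [conjPoly]
  | mul_X p i hp =>
    have hX : holVF f (X (Sum.inr i)) = 0 := by simp [holVF, pderiv_X]
    have hmul : conjPoly (p * X i) = conjPoly p * X (Sum.inr i) := by simp [conjPoly]
    rw [hmul, Derivation.leibniz, hp, hX]
    simp

theorem holVF_rename_inl (f : Fin 2 → P2) (q : P2) :
    holVF f (rename Sum.inl q) = rename Sum.inl (vf f q) := by
  simp [holVF, vf, pderiv_rename Sum.inl_injective]

/-- if a holomorphically nondegenerate model hypersurface `M_P`
admits a generalized rotation `Y` and `P` is decomposed via symmetric pairs of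
`Y`-chains of lengths `N_j`, then at least one chain has length `N_j ≥ 2`. -/
theorem stmt8 (μ : Fin 2 → ℚ) (hμ0 : 0 < μ 1) (hμ12 : μ 1 ≤ μ 0) (hμ1 : μ 0 ≤ 1 / 2)
    (P : P4)
    (hreal : ∀ z : Fin 2 → ℂ, (eval (mix z) P).im = 0)
    (hPhom : IsWeightedHomogeneous (Sum.elim μ μ) P 1)
    (hplh : ∀ m ∈ P.support, (∃ i, m (Sum.inl i) ≠ 0) ∧ (∃ i, m (Sum.inr i) ≠ 0))
    -- `M_P` is holomorphically nondegenerate: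
    (hnd : ∀ g : Fin 2 → P2,
      rename Sum.inl (g 0) * pderiv (Sum.inl 0) P +
        rename Sum.inl (g 1) * pderiv (Sum.inl 1) P = 0 → g = 0)
    -- `Y = f₁ ∂/∂z₁ + f₂ ∂/∂z₂` is a generalized rotation of `M_P`:
    (f : Fin 2 → P2) (hf : f ≠ 0) (δ : ℚ) (hδ : 0 < δ)
    (hfhom : ∀ j, IsWeightedHomogeneous μ (f j) (μ j + δ))
    (htan : ∀ z : Fin 2 → ℂ,
      (eval z (f 0) * eval (mix z) (pderiv (Sum.inl 0) P) +
       eval z (f 1) * eval (mix z) (pderiv (Sum.inl 1) P)).re = 0)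
    -- the chain decomposition of `P`:
    (M : ℕ) (hM : 1 ≤ M) (N : ℕ → ℕ) (hN : ∀ j, 1 ≤ j → j ≤ M → 1 ≤ N j)
    (U V : ℕ → ℕ → P2) (cc dd : ℕ → ℕ → ℂ)
    (hUhom : ∀ j, 1 ≤ j → j ≤ M → ∀ k, 1 ≤ k → k ≤ N j →
      ∃ a : ℚ, IsWeightedHomogeneous μ (U j k) a)
    (hVhom : ∀ j, 1 ≤ j → j ≤ M → ∀ k, 1 ≤ k → k ≤ N j →
      ∃ b : ℚ, IsWeightedHomogeneous μ (V j k) b)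
    (hchainU : ∀ j, 1 ≤ j → j ≤ M → vf f (U j (N j)) = 0)
    (hchainV : ∀ j, 1 ≤ j → j ≤ M → vf f (V j (N j)) = 0)
    (hchain : ∀ j, 1 ≤ j → j ≤ M → ∀ k, 1 ≤ k → k ≤ N j - 1 →
      cc j k ≠ 0 ∧ dd j k ≠ 0 ∧
      vf f (U j k) = C (cc j k) * U j (k + 1) ∧
      vf f (V j k) = C (dd j k) * V j (k + 1) ∧
      cc j k = - (starRingEnd ℂ) (dd j (N j - k)))
    (hP : ∀ z : Fin 2 → ℂ,
      eval (mix z) P =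
        ((∑ j ∈ Finset.Icc 1 M,
            (∑ k ∈ Finset.Icc 1 (N j),
              eval z (U j k) * (starRingEnd ℂ) (eval z (V j (N j - k + 1)))).re : ℝ) : ℂ)) :
    ∃ j, 1 ≤ j ∧ j ≤ M ∧ 2 ≤ N j := by
  by_contra! hshort
  have hone (j) (hj : j ∈ Finset.Icc 1 M) : N j = 1 := by
    obtain ⟨h1, h2⟩ := Finset.mem_Icc.mp hj
    exact le_antisymm (Nat.le_of_lt_succ (hshort j h1 h2)) (hN j h1 h2)
  have hdecomp : P = ∑ j ∈ Finset.Icc 1 M, C (1 / 2) *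
      (rename Sum.inl (U j 1) * conjPoly (V j 1) + conjPoly (U j 1) * rename Sum.inl (V j 1)) := by
    refine sub_eq_zero.mp (eq_zero_of_eval_mix _ fun z => ?_)
    rw [map_sub, hP, map_sum, ofReal_sum, sub_eq_zero]
    refine Finset.sum_congr rfl fun j hj => ?_
    simp only [hone j hj, Finset.Icc_self, Finset.sum_singleton, re_eq_add_conj, map_mul, map_add,
      eval_C, eval_mix_conjPoly, eval_mix_rename_inl, conj_conj]
    ring
  refine hf (hnd f ?_)
  change holVF f P = 0
  rw [hdecomp, map_sum]
  refine Finset.sum_eq_zero fun j hj => ?_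
  obtain ⟨h1, h2⟩ := Finset.mem_Icc.mp hj
  have hU := hchainU j h1 h2
  have hV := hchainV j h1 h2
  rw [hone j hj] at hU hV
  rw [← smul_eq_C_mul, Derivation.map_smul, map_add, Derivation.leibniz, Derivation.leibniz,
    holVF_conjPoly, holVF_conjPoly, holVF_rename_inl, holVF_rename_inl, hU, hV]
  simp
end
end

section
/- Let M_P be a model hypersurface and Y = f₁∂/∂z₁ + f₂∂/∂z₂ a generalized rotation of M_P. Write the bihomogeneous expansion P = Σ_{k=1}^{l} P_k, where c₁ < c₂ < … < c_l are the distinct weighted degrees in the holomorphic variables z occurring among the monomials of P, and P_k collects all monomials of P whose z-part has weighted degree c_k. Then the lowest component factors: there exist holomorphic polynomials Q, Q' ∈ ℂ[z₁,z₂], weighted homogeneous of weighted degrees c₁ and 1−c₁ respectively, such that P₁(z,z̄) = Q(z)·conj(Q'(z)) for all z ∈ ℂ² and Y(Q') = 0. -/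
open MvPolynomial Complex

noncomputable section

/-- Weighted degree of the holomorphic (`z`-) part of a monomial exponent. -/
def holDeg (μ : Fin 2 → ℚ) (m : (Fin 2 ⊕ Fin 2) →₀ ℕ) : ℚ :=
  (m (Sum.inl 0) : ℚ) * μ 0 + (m (Sum.inl 1) : ℚ) * μ 1

section Slice

variable {σ τ R : Type*} [CommSemiring R]

/-- View a polynomial in the variables `σ ⊕ τ` as a polynomial in the variables `τ` with
coefficients polynomials in the variables `σ`. -/
def sumToIterRight : MvPolynomial (σ ⊕ τ) R →ₐ[R] MvPolynomial τ (MvPolynomial σ R) :=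
  aeval (Sum.elim (fun i => C (X i)) X)

/-- The coefficient of the monomial `α` in the variables `τ`, a polynomial in the variables `σ`. -/
def slice (α : τ →₀ ℕ) (F : MvPolynomial (σ ⊕ τ) R) : MvPolynomial σ R :=
  coeff α (sumToIterRight F)

lemma slice_add (α : τ →₀ ℕ) (F G : MvPolynomial (σ ⊕ τ) R) :
    slice α (F + G) = slice α F + slice α G := by
  simp [slice]

lemma exists_sumElim_eq (m : σ ⊕ τ →₀ ℕ) :
    ∃ (β : σ →₀ ℕ) (α : τ →₀ ℕ), Finsupp.sumElim β α = m :=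
  ⟨_, _, Finsupp.comapDomain_sumElim_comapDomain m⟩

lemma sumElim_inj {β β' : σ →₀ ℕ} {α α' : τ →₀ ℕ} :
    Finsupp.sumElim β α = Finsupp.sumElim β' α' ↔ β = β' ∧ α = α' := by
  refine ⟨fun h => ⟨?_, ?_⟩, fun h => by rw [h.1, h.2]⟩
  · ext i
    simpa using DFunLike.congr_fun h (Sum.inl i)
  · ext i
    simpa using DFunLike.congr_fun h (Sum.inr i)

lemma sumToIterRight_monomial (β : σ →₀ ℕ) (α : τ →₀ ℕ) (c : R) :
    sumToIterRight (monomial (Finsupp.sumElim β α) c) = monomial α (monomial β c) := by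
  rw [sumToIterRight, aeval_monomial, Finsupp.prod_sumElim, monomial_eq (s := α),
    monomial_eq (s := β), C_mul, mul_assoc]
  simp only [Finsupp.prod, map_prod, map_pow]
  rfl

lemma coeff_slice (β : σ →₀ ℕ) (α : τ →₀ ℕ) (F : MvPolynomial (σ ⊕ τ) R) :
    coeff β (slice α F) = coeff (Finsupp.sumElim β α) F := by
  classical
  induction F using MvPolynomial.induction_on' with
  | add p q hp hq => simp [slice_add, hp, hq]
  | monomial m c =>
    obtain ⟨β', α', rfl⟩ := exists_sumElim_eq m
    rw [slice, sumToIterRight_monomial, coeff_monomial, coeff_monomial]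
    simp only [sumElim_inj]
    by_cases h : α' = α <;> simp [h, coeff_monomial]

lemma slice_rename_inl_mul (α : τ →₀ ℕ) (g : MvPolynomial σ R) (F : MvPolynomial (σ ⊕ τ) R) :
    slice α (rename Sum.inl g * F) = g * slice α F := by
  have h : sumToIterRight (rename (Sum.inl : σ → σ ⊕ τ) g) = C g := by
    induction g using MvPolynomial.induction_on with
    | C a =>
      rw [rename_C, sumToIterRight, aeval_C]
      rfl
    | add p q hp hq => simp [hp, hq]
    | mul_X p i hp =>
      rw [map_mul, map_mul, hp]
      simp [sumToIterRight]
  rw [slice, map_mul, h, coeff_C_mul, slice]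

lemma slice_rename_inr (α : τ →₀ ℕ) (g : MvPolynomial τ R) :
    slice α (rename (Sum.inr : τ → σ ⊕ τ) g) = C (coeff α g) := by
  have h : sumToIterRight (rename (Sum.inr : τ → σ ⊕ τ) g) = map C g := by
    induction g using MvPolynomial.induction_on with
    | C a =>
      rw [rename_C, sumToIterRight, aeval_C, map_C]
      rfl
    | add p q hp hq => simp [hp, hq]
    | mul_X p i hp =>
      rw [map_mul, map_mul, hp]
      simp [sumToIterRight]
  rw [slice, h, coeff_map]

lemma coeff_rename_inl_mul_rename_inr (β : σ →₀ ℕ) (α : τ →₀ ℕ) (g : MvPolynomial σ R)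
    (h : MvPolynomial τ R) :
    coeff (Finsupp.sumElim β α) (rename Sum.inl g * rename Sum.inr h) =
      coeff β g * coeff α h := by
  rw [← coeff_slice, slice_rename_inl_mul, slice_rename_inr, mul_comm g, coeff_C_mul, mul_comm]

lemma pderiv_slice (i : σ) (α : τ →₀ ℕ) (F : MvPolynomial (σ ⊕ τ) R) :
    pderiv i (slice α F) = slice α (pderiv (Sum.inl i) F) := by
  ext β
  rw [coeff_pderiv, coeff_slice, coeff_slice, coeff_pderiv]
  have h : Finsupp.sumElim β α + Finsupp.single (Sum.inl i) 1 =
      Finsupp.sumElim (β + Finsupp.single i 1) α := by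
    classical
    ext (j | j) <;> simp [Finsupp.single_apply]
  rw [h]
  rfl

end Slice

/-- The conjugate polynomial, with the holomorphic and antiholomorphic variables exchanged. -/
def conjSwap : P4 →+* P4 :=
  (map (starRingEnd ℂ)).comp (rename Sum.swap : P4 →ₐ[ℂ] P4).toRingHom

lemma coeff_conjSwap (α β : Fin 2 →₀ ℕ) (F : P4) :
    coeff (Finsupp.sumElim α β) (conjSwap F) =
      (starRingEnd ℂ) (coeff (Finsupp.sumElim β α) F) := by
  have h := coeff_rename_mapDomain Sum.swap Sum.swap_leftInverse.injective F
    (Finsupp.sumElim β α)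
  rw [Finsupp.mapDomain_swap_sumElim] at h
  simp [conjSwap, coeff_map, h]

lemma eval_mix_conjSwap (z : Fin 2 → ℂ) (F : P4) :
    eval (mix z) (conjSwap F) = (starRingEnd ℂ) (eval (mix z) F) := by
  induction F using MvPolynomial.induction_on with
  | C a => simp [conjSwap]
  | add p q hp hq => simp [hp, hq]
  | mul_X p i hp => rcases i with i | i <;> simp_all [conjSwap, mix]

/-- The points `(z, z̄)` are Zariski dense in `ℂ⁴`. -/
lemma eq_zero_of_eval_mix_eq_zero (F : P4) (h : ∀ z, eval (mix z) F = 0) : F = 0 := by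
  let s : Fin 2 ⊕ Fin 2 → P4 := Sum.elim (fun j => X (Sum.inl j) + C I * X (Sum.inr j))
    (fun j => X (Sum.inl j) - C I * X (Sum.inr j))
  have heval : ∀ v : Fin 2 ⊕ Fin 2 → ℂ, eval v (bind₁ s F) = eval (fun i => eval v (s i)) F :=
    fun v => eval₂Hom_bind₁ (RingHom.id ℂ) v s F
  have hs : bind₁ s F = 0 := by
    refine funext_set (fun _ => Set.range ((↑) : ℝ → ℂ))
      (fun _ => Set.infinite_range_of_injective ofReal_injective) fun v hv => ?_
    have hr : ∀ i, (starRingEnd ℂ) (v i) = v i := by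
      intro i
      obtain ⟨r, hr⟩ := hv i (Set.mem_univ i)
      rw [← hr, conj_ofReal]
    rw [heval, map_zero, ← h fun j => v (Sum.inl j) + I * v (Sum.inr j)]
    congr 2
    funext i
    rcases i with i | i <;> simp [s, mix, hr, sub_eq_add_neg]
  refine MvPolynomial.funext fun u => ?_
  have hu := heval (Sum.elim (fun j => (u (Sum.inl j) + u (Sum.inr j)) / 2)
    (fun j => (u (Sum.inl j) - u (Sum.inr j)) / (2 * I)))
  rw [hs, map_zero] at hu
  rw [map_zero, hu]
  congr 2
  funext i
  rcases i with i | i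
  · simp [s]
    field_simp
    ring
  · simp [s]
    field_simp
    ring

lemma coeff_X_mul_pderiv (i : Fin 2) (m : Fin 2 →₀ ℕ) (F : P2) :
    coeff m (X i * pderiv i F) = m i * coeff m F := by
  classical
  induction F using MvPolynomial.induction_on' with
  | add p q hp hq => simp [mul_add, hp, hq]
  | monomial n c =>
    rw [X_mul_pderiv_monomial, coeff_smul, coeff_monomial]
    split_ifs with h <;> simp [h]

lemma weight_fin_two (μ : Fin 2 → ℚ) (m : Fin 2 →₀ ℕ) :
    Finsupp.weight μ m = m 0 * μ 0 + m 1 * μ 1 := by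
  rw [Finsupp.weight_apply, Finsupp.sum_fintype _ _ (by simp)]
  simp

/-- Weighted homogeneous polynomials of the same nonzero degree with vanishing Jacobian
determinant are proportional. -/
lemma coeff_mul_coeff_eq_of_jacobian_eq_zero {μ : Fin 2 → ℚ} {d : ℚ} (hd : d ≠ 0) {A B : P2}
    (hA : IsWeightedHomogeneous μ A d) (hB : IsWeightedHomogeneous μ B d)
    (hJ : pderiv 0 A * pderiv 1 B = pderiv 1 A * pderiv 0 B) (k l : Fin 2 →₀ ℕ) :
    coeff k A * coeff l B = coeff l A * coeff k B := by
  by_cases hB0 : B = 0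
  · simp [hB0]
  let o : MonomialOrder (Fin 2) := MonomialOrder.lex
  set m := o.degree B
  have hm : coeff m B ≠ 0 := o.leadingCoeff_ne_zero_iff.2 hB0
  set W : P2 := C (coeff m B) * A - C (coeff m A) * B with hW
  have hWm : coeff m W = 0 := by
    rw [hW, coeff_sub, coeff_C_mul, coeff_C_mul, mul_comm, sub_self]
  have hWh : IsWeightedHomogeneous μ W d :=
    (weightedHomogeneousSubmodule ℂ μ d).sub_mem (hA.C_mul _) (hB.C_mul _)
  have hWJ : pderiv 0 W * pderiv 1 B = pderiv 1 W * pderiv 0 B := by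
    simp only [hW, map_sub, pderiv_C_mul]
    linear_combination C (coeff m B) * hJ
  have hW0 : W = 0 := by
    by_contra hne
    set n := o.degree W
    have hn : coeff n W ≠ 0 := o.leadingCoeff_ne_zero_iff.2 hne
    have hdeg : ∀ (i : Fin 2) (F : P2), o.toSyn (o.degree (X i * pderiv i F)) ≤
        o.toSyn (o.degree F) := by
      intro i F
      refine o.degree_le_iff.2 fun c hc => o.le_degree ?_
      rw [mem_support_iff, coeff_X_mul_pderiv] at hc
      exact mem_support_iff.2 (right_ne_zero_of_mul hc)
    have key : (X 0 * pderiv 0 W) * (X 1 * pderiv 1 B) =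
        (X 1 * pderiv 1 W) * (X 0 * pderiv 0 B) := by
      linear_combination X 0 * X 1 * hWJ
    have hc := congrArg (coeff (n + m)) key
    rw [o.coeff_mul_of_add_of_degree_le (hdeg 0 W) (hdeg 1 B),
      o.coeff_mul_of_add_of_degree_le (hdeg 1 W) (hdeg 0 B)] at hc
    simp only [coeff_X_mul_pderiv] at hc
    have hc' : (n 0 : ℂ) * m 1 = n 1 * m 0 :=
      mul_right_cancel₀ (mul_ne_zero hn hm) (by linear_combination hc)
    have hq : (n 0 : ℚ) * m 1 = n 1 * m 0 := by exact_mod_cast hc'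
    have hnd := hWh hn
    have hmd := hB hm
    rw [weight_fin_two] at hnd hmd
    have h0 : (n 0 : ℚ) = m 0 := mul_left_cancel₀ hd (by
      linear_combination (-(n 0 : ℚ)) * hmd + (m 0 : ℚ) * hnd + μ 1 * hq)
    have h1 : (n 1 : ℚ) = m 1 := mul_left_cancel₀ hd (by
      linear_combination (-(n 1 : ℚ)) * hmd + (m 1 : ℚ) * hnd - μ 0 * hq)
    have hnm : n = m := by
      ext i
      fin_cases i
      · exact_mod_cast h0
      · exact_mod_cast h1
    exact hn (hnm ▸ hWm)
  have hk := congrArg (coeff k) hW0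
  have hl := congrArg (coeff l) hW0
  simp only [hW, coeff_sub, coeff_C_mul, coeff_zero] at hk hl
  refine mul_left_cancel₀ hm ?_
  linear_combination coeff l B * hk - coeff k B * hl

/-- The first integrals of a nonzero planar vector field have vanishing Jacobian determinant. -/
lemma jacobian_eq_zero_of_vf_eq_zero {f : Fin 2 → P2} (hf : f ≠ 0) {A B : P2}
    (hA : vf f A = 0) (hB : vf f B = 0) :
    pderiv 0 A * pderiv 1 B = pderiv 1 A * pderiv 0 B := by
  rw [vf] at hA hB
  obtain ⟨i, hi⟩ := Function.ne_iff.1 hf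
  refine mul_left_cancel₀ hi ?_
  fin_cases i
  · change f 0 * _ = f 0 * _
    linear_combination pderiv 1 B * hA - pderiv 1 A * hB
  · change f 1 * _ = f 1 * _
    linear_combination pderiv 0 A * hB - pderiv 0 B * hA

lemma weight_sumElim (μ : Fin 2 → ℚ) (β α : Fin 2 →₀ ℕ) :
    Finsupp.weight (Sum.elim μ μ) (Finsupp.sumElim β α) =
      Finsupp.weight μ β + Finsupp.weight μ α := by
  rw [Finsupp.weight_apply, Finsupp.sum_fintype _ _ (by simp)]
  simp [weight_fin_two]

lemma holDeg_sumElim (μ : Fin 2 → ℚ) (β α : Fin 2 →₀ ℕ) :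
    holDeg μ (Finsupp.sumElim β α) = Finsupp.weight μ β := by
  simp [holDeg, weight_fin_two]

lemma isWeightedHomogeneous_slice {μ : Fin 2 → ℚ} {F : P4} {d : ℚ}
    (hF : IsWeightedHomogeneous (Sum.elim μ μ) F d) (α : Fin 2 →₀ ℕ) :
    IsWeightedHomogeneous μ (slice α F) (d - Finsupp.weight μ α) := by
  intro β hβ
  rw [coeff_slice] at hβ
  rw [← hF hβ, weight_sumElim, add_sub_cancel_right]

lemma isWeightedHomogeneous_vf {μ : Fin 2 → ℚ} {f : Fin 2 → P2} {δ d : ℚ}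
    (hf : ∀ j, IsWeightedHomogeneous μ (f j) (μ j + δ)) {q : P2}
    (hq : IsWeightedHomogeneous μ q d) : IsWeightedHomogeneous μ (vf f q) (d + δ) := by
  have h : ∀ j, IsWeightedHomogeneous μ (f j * pderiv j q) (d + δ) := by
    intro j
    have := (hf j).mul (hq.pderiv (i := j) (n' := d - μ j) (by ring))
    rwa [show μ j + δ + (d - μ j) = d + δ by ring] at this
  exact (h 0).add (h 1)

/-- the lowest bihomogeneous component `P₁` of `P` (the sum of the
monomials of `P` whose `z`-part has the minimal weighted degree `c₁`) factors as
`P₁ = Q(z) · conj (Q'(z))` with `Q, Q'` weighted homogeneous of weighted degrees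
`c₁` and `1 - c₁`, and `Y(Q') = 0`. -/
theorem stmt10 (μ : Fin 2 → ℚ) (hμ0 : 0 < μ 1) (hμ12 : μ 1 ≤ μ 0) (hμ1 : μ 0 ≤ 1 / 2)
    (P : P4)
    (hreal : ∀ z : Fin 2 → ℂ, (eval (mix z) P).im = 0)
    (hPhom : IsWeightedHomogeneous (Sum.elim μ μ) P 1)
    (hplh : ∀ m ∈ P.support, (∃ i, m (Sum.inl i) ≠ 0) ∧ (∃ i, m (Sum.inr i) ≠ 0))
    -- `Y = f₁ ∂/∂z₁ + f₂ ∂/∂z₂` is a generalized rotation of `M_P`: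
    (f : Fin 2 → P2) (hf : f ≠ 0) (δ : ℚ) (hδ : 0 < δ)
    (hfhom : ∀ j, IsWeightedHomogeneous μ (f j) (μ j + δ))
    (htan : ∀ z : Fin 2 → ℂ,
      (eval z (f 0) * eval (mix z) (pderiv (Sum.inl 0) P) +
       eval z (f 1) * eval (mix z) (pderiv (Sum.inl 1) P)).re = 0)
    -- `c₁` is the minimal weighted degree in `z` among the monomials of `P`,
    -- and `P₁` collects the monomials of `P` with `z`-part of weighted degree `c₁`:
    (c1 : ℚ) (hc1 : ∃ m ∈ P.support, holDeg μ m = c1)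
    (hmin : ∀ m ∈ P.support, c1 ≤ holDeg μ m)
    (P1 : P4) (hP1 : ∀ m, coeff m P1 = if holDeg μ m = c1 then coeff m P else 0) :
    ∃ Q Q' : P2,
      IsWeightedHomogeneous μ Q c1 ∧
      IsWeightedHomogeneous μ Q' (1 - c1) ∧
      (∀ z : Fin 2 → ℂ,
        eval (mix z) P1 = eval z Q * (starRingEnd ℂ) (eval z Q')) ∧
      vf f Q' = 0 := by
  have hPc : ∀ α β, coeff (Finsupp.sumElim α β) P =
      (starRingEnd ℂ) (coeff (Finsupp.sumElim β α) P) := by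
    have h : conjSwap P - P = 0 := eq_zero_of_eval_mix_eq_zero _ fun z => by
      rw [map_sub, eval_mix_conjSwap, conj_eq_iff_im.2 (hreal z), sub_self]
    intro α β
    rw [← coeff_conjSwap, sub_eq_zero.1 h]
  set D : P4 := rename Sum.inl (f 0) * pderiv (Sum.inl 0) P +
    rename Sum.inl (f 1) * pderiv (Sum.inl 1) P with hD
  have hDc : ∀ α β, coeff (Finsupp.sumElim α β) D =
      -(starRingEnd ℂ) (coeff (Finsupp.sumElim β α) D) := by
    have h : D + conjSwap D = 0 := eq_zero_of_eval_mix_eq_zero _ fun z => by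
      have hz : eval (mix z) D = eval z (f 0) * eval (mix z) (pderiv (Sum.inl 0) P) +
          eval z (f 1) * eval (mix z) (pderiv (Sum.inl 1) P) := by
        simp only [hD, map_add, map_mul, eval_rename]
        rfl
      rw [map_add, eval_mix_conjSwap, add_conj, hz, htan z, mul_zero, ofReal_zero]
    intro α β
    rw [← coeff_conjSwap]
    exact eq_neg_of_add_eq_zero_left (by rw [← coeff_add, h, coeff_zero])
  have hvf : ∀ α, vf f (slice α P) = slice α D := by
    intro α
    rw [vf, hD, slice_add, slice_rename_inl_mul, slice_rename_inl_mul, pderiv_slice, pderiv_slice]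
  have hslice := isWeightedHomogeneous_slice hPhom
  have hker : ∀ α, Finsupp.weight μ α = c1 → vf f (slice α P) = 0 := by
    intro α hα
    ext β
    rw [hvf, coeff_slice, coeff_zero, hDc, ← coeff_slice, ← hvf, neg_eq_zero, map_eq_zero]
    by_contra hne
    have hdeg := isWeightedHomogeneous_vf hfhom (hslice β) hne
    have h0 : slice β P ≠ 0 := fun h => hne (by simp [vf, h])
    obtain ⟨γ, hγ⟩ := ne_zero_iff.1 h0
    have hγd := hslice β hγ
    rw [coeff_slice] at hγ
    have hle := hmin _ (mem_support_iff.2 hγ)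
    rw [holDeg_sumElim] at hle
    linarith
  obtain ⟨m, hm, hmc⟩ := hc1
  have hplm := (hplh m hm).2
  obtain ⟨α₀, β₀, rfl⟩ := exists_sumElim_eq m
  rw [holDeg_sumElim] at hmc
  rw [mem_support_iff] at hm
  have hβ₀ : Finsupp.weight μ β₀ = 1 - c1 := by
    have := hPhom hm
    rw [weight_sumElim] at this
    linarith
  have hd : 1 - c1 ≠ 0 := by
    rw [← hβ₀, weight_fin_two]
    have hμ0' : 0 < μ 0 := hμ0.trans_le hμ12
    obtain ⟨i, hi⟩ := hplm
    rw [Finsupp.sumElim_inr] at hi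
    have hi' : (0 : ℚ) < β₀ i := by exact_mod_cast Nat.pos_of_ne_zero hi
    fin_cases i
    · exact (add_pos_of_pos_of_nonneg (mul_pos hi' hμ0') (by positivity)).ne'
    · exact (add_pos_of_nonneg_of_pos (by positivity) (mul_pos hi' hμ0)).ne'
  have hP1c : ∀ α β, coeff (Finsupp.sumElim α β) P1 =
      if Finsupp.weight μ α = c1 then coeff (Finsupp.sumElim α β) P else 0 := by
    intro α β
    rw [hP1, holDeg_sumElim]
  refine ⟨C (coeff (Finsupp.sumElim α₀ β₀) P)⁻¹ * slice β₀ P1, slice α₀ P, ?_, ?_, ?_,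
    hker α₀ hmc⟩
  · refine IsWeightedHomogeneous.C_mul (fun α hα => ?_) _
    rw [coeff_slice, hP1c] at hα
    by_contra h
    exact hα (if_neg h)
  · exact hmc ▸ hslice α₀
  · have hfac : P1 = rename Sum.inl (C (coeff (Finsupp.sumElim α₀ β₀) P)⁻¹ * slice β₀ P1) *
        rename Sum.inr (map (starRingEnd ℂ) (slice α₀ P)) := by
      ext m
      obtain ⟨α, β, rfl⟩ := exists_sumElim_eq m
      rw [coeff_rename_inl_mul_rename_inr, coeff_C_mul, coeff_map, coeff_slice, coeff_slice,
        ← hPc, hP1c, hP1c]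
      split_ifs with hα
      · have hJ := coeff_mul_coeff_eq_of_jacobian_eq_zero hd (hα ▸ hslice α) (hmc ▸ hslice α₀)
          (jacobian_eq_zero_of_vf_eq_zero hf (hker α hα) (hker α₀ hmc)) β β₀
        have hJ' := congrArg (starRingEnd ℂ) hJ
        simp only [map_mul, coeff_slice, ← hPc] at hJ'
        field_simp
        linear_combination hJ'
      · simp
    intro z
    conv_lhs => rw [hfac]
    rw [map_mul, eval_rename, eval_rename]
    congr 1
    change eval (fun j => (starRingEnd ℂ) (z j)) _ = _
    rw [eval_map, eval₂_comp]
    rfl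
end
end
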